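/- The sum over all a,b,c,d ∈ ℤ_{≥0} with a ≥ 1 and ad − bc = 1 of (ab/√(a²+b²) + cd/√(c²+d²) − (a+c)(b+d)/√((a+c)²+(b+d)²))² converges and equals 3π/16. -/

import Mathlib

open Real

/-- The astroid support value `ab/√(a²+b²)`. -/
noncomputable def h (a b : ℕ) : ℝ := (a : ℝ) * b / Real.sqrt ((a : ℝ) ^ 2 + (b : ℝ) ^ 2)

/-- The index set of the sum. -/
abbrev Idx : Type := {x : ℕ × ℕ × ℕ × ℕ //
        1 ≤ x.1 ∧ x.1 * x.2.2.2 = x.2.1 * x.2.2.1 + 1}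

/-- Left child in the Stern-Brocot tree. -/
def lft (x : Idx) : Idx :=
  ⟨(x.1.1, x.1.2.1, x.1.1 + x.1.2.2.1, x.1.2.1 + x.1.2.2.2), by
    obtain ⟨⟨a, b, c, d⟩, h1, h2⟩ := x
    simp only at *
    exact ⟨h1, by nlinarith⟩⟩

/-- Right child in the Stern-Brocot tree. -/
def rgt (x : Idx) : Idx :=
  ⟨(x.1.1 + x.1.2.2.1, x.1.2.1 + x.1.2.2.2, x.1.2.2.1, x.1.2.2.2), by
    obtain ⟨⟨a, b, c, d⟩, h1, h2⟩ := x
    simp only at *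
    exact ⟨by omega, by nlinarith⟩⟩

/-- The root. -/
def root : Idx := ⟨(1, 0, 0, 1), by simp⟩

theorem lft_inj : Function.Injective lft := by
  rintro ⟨⟨a, b, c, d⟩, h1, h2⟩ ⟨⟨a', b', c', d'⟩, h1', h2'⟩ h
  simp only [lft, Subtype.mk.injEq, Prod.mk.injEq] at h ⊢
  omega

theorem rgt_inj : Function.Injective rgt := by
  rintro ⟨⟨a, b, c, d⟩, h1, h2⟩ ⟨⟨a', b', c', d'⟩, h1', h2'⟩ h
  simp only [rgt, Subtype.mk.injEq, Prod.mk.injEq] at h ⊢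
  omega

theorem lft_ne_rgt (x y : Idx) : lft x ≠ rgt y := by
  obtain ⟨⟨a, b, c, d⟩, h1, h2⟩ := x
  obtain ⟨⟨a', b', c', d'⟩, h1', h2'⟩ := y
  intro h
  simp only [lft, rgt, Subtype.mk.injEq, Prod.mk.injEq] at h h1'
  omega

theorem lft_ne_root (x : Idx) : lft x ≠ root := by
  obtain ⟨⟨a, b, c, d⟩, h1, h2⟩ := x
  intro h
  simp only [lft, root, Subtype.mk.injEq, Prod.mk.injEq] at h
  omega

theorem rgt_ne_root (x : Idx) : rgt x ≠ root := by
  obtain ⟨⟨a, b, c, d⟩, h1, h2⟩ := x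
  intro h
  simp only [rgt, root, Subtype.mk.injEq, Prod.mk.injEq] at h
  obtain ⟨e1, e2, e3, e4⟩ := h
  omega

theorem eq_cases (x : Idx) : x = root ∨ (∃ y, x = lft y) ∨ (∃ y, x = rgt y) := by
  obtain ⟨⟨a, b, c, d⟩, h1, h2⟩ := x
  simp only at h1 h2
  by_cases hac : a ≤ c
  · right; left
    have hbd : b ≤ d := by
      by_contra hlt
      push Not at hlt
      nlinarith
    obtain ⟨c', rfl⟩ := Nat.exists_eq_add_of_le hac
    obtain ⟨d', rfl⟩ := Nat.exists_eq_add_of_le hbd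
    exact ⟨⟨(a, b, c', d'), h1, by simp only; nlinarith⟩, rfl⟩
  · push Not at hac
    by_cases hbd : d ≤ b
    · right; right
      obtain ⟨a', rfl⟩ := Nat.exists_eq_add_of_le hac.le
      obtain ⟨b', rfl⟩ := Nat.exists_eq_add_of_le hbd
      refine ⟨⟨(a', b', c, d), by simp only; omega, by simp only; nlinarith⟩, ?_⟩
      simp only [rgt, Subtype.mk.injEq, Prod.mk.injEq]
      simp [add_comm]
    · left
      push Not at hbd
      have hb : b = 0 := by
        by_contra hb
        have : 1 ≤ b := Nat.one_le_iff_ne_zero.mpr hb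
        nlinarith
      have hc : c = 0 := by
        by_contra hc
        have : 1 ≤ c := Nat.one_le_iff_ne_zero.mpr hc
        nlinarith
      subst hb hc
      have : a * d = 1 := by simpa using h2
      obtain ⟨rfl, rfl⟩ := mul_eq_one.mp this
      rfl

open Classical in
/-- Nodes at depth `n`. -/
noncomputable def Lv : ℕ → Finset Idx
  | 0 => {root}
  | n + 1 => (Lv n).image lft ∪ (Lv n).image rgt

open Classical in
/-- Nodes at depth `< n`. -/
noncomputable def Tr : ℕ → Finset Idx
  | 0 => ∅
  | n + 1 => insert root ((Tr n).image lft ∪ (Tr n).image rgt)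

open Classical in
theorem sum_children (s : Finset Idx) (g : Idx → ℝ) :
    ∑ x ∈ s.image lft ∪ s.image rgt, g x = ∑ x ∈ s, (g (lft x) + g (rgt x)) := by
  rw [Finset.sum_union, Finset.sum_image (fun _ _ _ _ h => lft_inj h),
    Finset.sum_image (fun _ _ _ _ h => rgt_inj h), Finset.sum_add_distrib]
  rw [Finset.disjoint_left]
  intro x hx hy
  simp only [Finset.mem_image] at hx hy
  obtain ⟨y, _, rfl⟩ := hx
  obtain ⟨z, _, hz⟩ := hy
  exact lft_ne_rgt y z hz.symm

theorem sum_Lv_succ (n : ℕ) (g : Idx → ℝ) :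
    ∑ x ∈ Lv (n + 1), g x = ∑ x ∈ Lv n, (g (lft x) + g (rgt x)) := by
  rw [Lv, sum_children]

theorem sum_Tr_succ (n : ℕ) (g : Idx → ℝ) :
    ∑ x ∈ Tr (n + 1), g x = g root + ∑ x ∈ Tr n, (g (lft x) + g (rgt x)) := by
  rw [Tr, Finset.sum_insert, sum_children]
  simp only [Finset.mem_union, Finset.mem_image, not_or, not_exists, not_and]
  exact ⟨fun x _ => lft_ne_root x, fun x _ => rgt_ne_root x⟩

theorem sum_Tr (n : ℕ) : ∀ (g t : Idx → ℝ), (∀ x, t x = g x - g (lft x) - g (rgt x)) →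
    ∑ x ∈ Tr n, t x = g root - ∑ x ∈ Lv n, g x := by
  induction n with
  | zero => intro g t _; simp [Tr, Lv]
  | succ n ih =>
    intro g t h
    rw [sum_Tr_succ, sum_Lv_succ,
      ih (fun x => g (lft x) + g (rgt x)) (fun x => t (lft x) + t (rgt x))]
    · rw [h root]; ring
    · intro x
      simp only [h]
      ring

theorem Tr_mono : Monotone Tr := by
  classical
  apply monotone_nat_of_le_succ
  intro n
  induction n with
  | zero => simp [Tr]
  | succ n ih =>
    rw [Tr, Tr]
    exact Finset.insert_subset_insert _ (Finset.union_subset_union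
      (Finset.image_subset_image ih) (Finset.image_subset_image ih))

theorem mem_Tr (n : ℕ) : ∀ x : Idx, x.1.1 + x.1.2.1 + x.1.2.2.1 + x.1.2.2.2 ≤ n → x ∈ Tr n := by
  classical
  induction n with
  | zero =>
    intro x hx
    have := x.2.1
    omega
  | succ n ih =>
    intro x hx
    rw [Tr, Finset.mem_insert, Finset.mem_union, Finset.mem_image, Finset.mem_image]
    rcases eq_cases x with h | ⟨y, rfl⟩ | ⟨y, rfl⟩
    · exact Or.inl h
    · refine Or.inr (Or.inl ⟨y, ih y ?_, rfl⟩)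
      have := y.2.1
      simp only [lft] at hx
      omega
    · refine Or.inr (Or.inr ⟨y, ih y ?_, rfl⟩)
      have h1 := y.2.1
      have h2 : 1 ≤ y.1.2.2.2 := by
        by_contra h
        have h0 : y.1.2.2.2 = 0 := by omega
        have := y.2.2
        rw [h0] at this
        omega
      simp only [rgt] at hx
      omega

/-- Reciprocal weights summing to one on each level. -/
noncomputable def tau (x : Idx) : ℝ :=
  1 / (((x.1.1 : ℝ) + x.1.2.1) * ((x.1.2.2.1 : ℝ) + x.1.2.2.2))

theorem pos_fst (x : Idx) : (0 : ℝ) < (x.1.1 : ℝ) + x.1.2.1 := by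
  have := x.2.1
  have : 0 < x.1.1 + x.1.2.1 := by omega
  exact_mod_cast this

theorem pos_snd (x : Idx) : (0 : ℝ) < (x.1.2.2.1 : ℝ) + x.1.2.2.2 := by
  have : 0 < x.1.2.2.1 + x.1.2.2.2 := by
    by_contra h
    have h0 : x.1.2.2.2 = 0 := by omega
    have := x.2.2
    rw [h0] at this
    omega
  exact_mod_cast this

theorem tau_split (x : Idx) : tau (lft x) + tau (rgt x) = tau x := by
  have h1 := pos_fst x
  have h2 := pos_snd x
  have h3 : (0 : ℝ) < ((x.1.1 : ℝ) + x.1.2.1) + ((x.1.2.2.1 : ℝ) + x.1.2.2.2) := by linarith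
  have e1 : tau (lft x) = 1 / (((x.1.1 : ℝ) + x.1.2.1) *
      (((x.1.1 : ℝ) + x.1.2.1) + ((x.1.2.2.1 : ℝ) + x.1.2.2.2))) := by
    simp only [tau, lft]; push_cast; congr 2; ring
  have e2 : tau (rgt x) = 1 / ((((x.1.1 : ℝ) + x.1.2.1) + ((x.1.2.2.1 : ℝ) + x.1.2.2.2)) *
      ((x.1.2.2.1 : ℝ) + x.1.2.2.2)) := by
    simp only [tau, rgt]; push_cast; congr 2; ring
  rw [e1, e2, tau]
  generalize (x.1.1 : ℝ) + x.1.2.1 = p at *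
  generalize (x.1.2.2.1 : ℝ) + x.1.2.2.2 = q at *
  field_simp
  ring

theorem sum_tau (n : ℕ) : ∑ x ∈ Lv n, tau x = 1 := by
  induction n with
  | zero => simp [Lv, tau, root]
  | succ n ih =>
    rw [sum_Lv_succ, ← ih]
    exact Finset.sum_congr rfl fun x _ => tau_split x

theorem Lv_large (n : ℕ) : ∀ x ∈ Lv n,
    (n : ℝ) + 1 ≤ ((x.1.1 : ℝ) + x.1.2.1) * ((x.1.2.2.1 : ℝ) + x.1.2.2.2) := by
  classical
  induction n with
  | zero => simp [Lv, root]
  | succ n ih =>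
    intro x hx
    rw [Lv, Finset.mem_union, Finset.mem_image, Finset.mem_image] at hx
    rcases hx with ⟨y, hy, rfl⟩ | ⟨y, hy, rfl⟩
    · have h1 : (1 : ℝ) ≤ (y.1.1 : ℝ) + y.1.2.1 := by
        have := pos_fst y
        exact_mod_cast this
      have := ih y hy
      simp only [lft]; push_cast
      nlinarith
    · have h1 : (1 : ℝ) ≤ (y.1.2.2.1 : ℝ) + y.1.2.2.2 := by
        have := pos_snd y
        exact_mod_cast this
      have := ih y hy
      simp only [rgt]; push_cast
      nlinarith

theorem tau_le (n : ℕ) (x : Idx) (hx : x ∈ Lv n) : tau x ≤ 1 / ((n : ℝ) + 1) := by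
  unfold tau
  exact one_div_le_one_div_of_le (by positivity) (Lv_large n x hx)

/-- Antiderivative used for the arc part of the area. -/
noncomputable def Jf (t : ℝ) : ℝ := 3 / 8 * t + 5 / 32 * Real.sin (4 * t)

theorem angle_bound (α β : ℝ) (h0 : 0 < β - α) (h1 : β - α ≤ π / 2) :
    |2 * (cos α * sin α) * (cos β * sin β)
      - cos (β - α) * ((cos α * sin α) ^ 2 + (cos β * sin β) ^ 2)
      + sin (β - α) * (Jf β - Jf α)| ≤ sin (β - α) ^ 4 := by
  obtain ⟨D, hD⟩ : ∃ D, D = β - α := ⟨_, rfl⟩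
  obtain ⟨S, hS⟩ : ∃ S, S = β + α := ⟨_, rfl⟩
  rw [← hD] at h0 h1 ⊢
  have ea : cos α * sin α = sin (S - D) / 2 := by
    rw [show S - D = 2 * α by rw [hS, hD]; ring, sin_two_mul]; ring
  have eb : cos β * sin β = sin (S + D) / 2 := by
    rw [show S + D = 2 * β by rw [hS, hD]; ring, sin_two_mul]; ring
  have eJ : Jf β - Jf α = 3 / 8 * D + 5 / 8 * cos (2 * S) * (sin D * cos D) := by
    unfold Jf
    rw [show 4 * β = 2 * S + 2 * D by rw [hS, hD]; ring,
      show 4 * α = 2 * S - 2 * D by rw [hS, hD]; ring, sin_add, sin_sub, sin_two_mul D]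
    rw [hD]; ring
  have hs : 0 < sin D := sin_pos_of_pos_of_lt_pi h0 (by linarith [pi_pos])
  have hc : 0 ≤ cos D := cos_nonneg_of_neg_pi_div_two_le_of_le (by linarith) h1
  have hsc := sin_sq_add_cos_sq D
  have hSC := sin_sq_add_cos_sq S
  have hK1 := cos_le_one (2 * S)
  have hK2 := neg_one_le_cos (2 * S)
  have hc1 := cos_le_one D
  have hds : D - sin D ≤ sin D ^ 3 := by
    have k1 := Real.sin_ge_sub_cube h0.le
    have k2 := Real.mul_le_sin h0.le h1
    have k3 : D ≤ 1.6 * sin D := by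
      have hp := pi_pos
      have hp2 := Real.pi_lt_d2
      have : D = π / 2 * (2 / π * D) := by field_simp
      nlinarith
    have k4 : D ^ 3 ≤ (1.6 * sin D) ^ 3 := pow_le_pow_left₀ h0.le k3 3
    have k5 : 0 < sin D ^ 3 := by positivity
    nlinarith
  have hds0 : 0 ≤ D - sin D := by linarith [sin_le h0.le]
  have key : 2 * (cos α * sin α) * (cos β * sin β)
      - cos D * ((cos α * sin α) ^ 2 + (cos β * sin β) ^ 2)
      + sin D * (Jf β - Jf α) =
      (1 - cos D) ^ 2 / 8 + 3 / 8 * sin D * (D - sin D)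
      - cos (2 * S) * ((1 - cos D) ^ 2 / 8 + (1 - cos D) * sin D ^ 2 / 8) := by
    rw [ea, eb, eJ, sin_add, sin_sub, cos_two_mul]
    generalize sin D = s at *
    generalize cos D = c at *
    generalize sin S = p at *
    generalize cos S = q at *
    have e1 : s ^ 2 = 1 - c ^ 2 := by linarith
    have e2 : p ^ 2 = 1 - q ^ 2 := by linarith
    grind
  rw [key]
  generalize cos (2 * S) = K at *
  have hu : 1 - cos D ≤ sin D ^ 2 := by nlinarith
  have hu0 : 0 ≤ 1 - cos D := by linarith
  generalize 1 - cos D = u at *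
  generalize sin D = s at *
  have m1 : u ^ 2 ≤ s ^ 4 := by nlinarith
  have m2 : u * s ^ 2 ≤ s ^ 4 := by nlinarith [sq_nonneg s]
  have m3 : s * (D - s) ≤ s ^ 4 := by nlinarith
  have m4 : 0 ≤ s * (D - s) := by positivity
  have m5 : 0 ≤ u * s ^ 2 := by positivity
  have m6 : 0 ≤ u ^ 2 := by positivity
  have m7 : 0 ≤ s ^ 4 := by positivity
  obtain ⟨W, hW⟩ : ∃ W, W = u ^ 2 / 8 + u * s ^ 2 / 8 := ⟨_, rfl⟩
  have hW0 : 0 ≤ W := by rw [hW]; positivity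
  have m8 : K * W ≤ W := mul_le_of_le_one_left hW0 hK1
  have m9 : 0 ≤ (K + 1) * W := mul_nonneg (by linarith) hW0
  rw [← hW, abs_le]
  constructor <;> linarith

/-- Angle of a vector. -/
noncomputable def ang (a b : ℕ) : ℝ := Complex.arg ⟨a, b⟩

/-- Length of a vector. -/
noncomputable def len (a b : ℕ) : ℝ := Real.sqrt ((a : ℝ) ^ 2 + (b : ℝ) ^ 2)

theorem len_sq (a b : ℕ) : len a b ^ 2 = (a : ℝ) ^ 2 + (b : ℝ) ^ 2 :=
  Real.sq_sqrt (by positivity)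

theorem len_pos (a b : ℕ) (hab : 0 < a + b) : 0 < len a b := by
  apply Real.sqrt_pos.mpr
  rcases Nat.eq_zero_or_pos a with h | h
  · have : 0 < b := by omega
    positivity
  · positivity

theorem norm_eq (a b : ℕ) : ‖(⟨a, b⟩ : ℂ)‖ = len a b := by
  rw [Complex.norm_eq_sqrt_sq_add_sq, len]

theorem cos_ang (a b : ℕ) (hab : 0 < a + b) : len a b * cos (ang a b) = a := by
  have hl := len_pos a b hab
  have hne : (⟨a, b⟩ : ℂ) ≠ 0 := by
    intro h
    have := norm_eq a b
    rw [h, norm_zero] at this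
    linarith
  rw [ang, Complex.cos_arg hne, norm_eq]
  field_simp

theorem sin_ang (a b : ℕ) (hab : 0 < a + b) : len a b * sin (ang a b) = b := by
  have hl := len_pos a b hab
  rw [ang, Complex.sin_arg, norm_eq]
  field_simp

theorem ang_nonneg (a b : ℕ) : 0 ≤ ang a b := by
  rw [ang, Complex.arg_nonneg_iff]
  simp

theorem ang_le (a b : ℕ) : ang a b ≤ π / 2 := by
  rw [ang, Complex.arg_le_pi_div_two_iff]
  simp

/-- Twice the area of the region cut between two tangents and the astroid. -/
noncomputable def Gf (a b c d : ℕ) : ℝ :=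
  2 * h a b * h c d - ((a : ℝ) * c + b * d) *
    ((h a b / len a b) ^ 2 + (h c d / len c d) ^ 2) + (Jf (ang c d) - Jf (ang a b))

theorem h_eq (a b : ℕ) (hab : 0 < a + b) :
    h a b = len a b * (cos (ang a b) * sin (ang a b)) := by
  have hl := len_pos a b hab
  have e : h a b = (a : ℝ) * b / len a b := rfl
  rw [e, div_eq_iff hl.ne']
  linear_combination (-(b : ℝ)) * cos_ang a b hab -
    len a b * cos (ang a b) * sin_ang a b hab

theorem Gf_bound (a b c d : ℕ) (hab : 0 < a + b) (hcd : 0 < c + d) (hdet : a * d = b * c + 1) :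
    |Gf a b c d| * (len a b * len c d) ^ 3 ≤ 1 := by
  have hr := len_pos a b hab
  have hR := len_pos c d hcd
  have ca := cos_ang a b hab
  have sa := sin_ang a b hab
  have cc := cos_ang c d hcd
  have sc := sin_ang c d hcd
  have n1 := ang_nonneg a b
  have n2 := ang_le a b
  have n3 := ang_nonneg c d
  have n4 := ang_le c d
  have hG : Gf a b c d = 2 * h a b * h c d - ((a : ℝ) * c + b * d) *
    ((h a b / len a b) ^ 2 + (h c d / len c d) ^ 2) + (Jf (ang c d) - Jf (ang a b)) := rfl
  have hd : (a : ℝ) * d = b * c + 1 := by exact_mod_cast hdet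
  rw [h_eq a b hab, h_eq c d hcd, ← ca, ← sa, ← cc, ← sc,
    mul_div_cancel_left₀ _ hr.ne', mul_div_cancel_left₀ _ hR.ne'] at hG
  rw [← ca, ← sa, ← cc, ← sc] at hd
  generalize Gf a b c d = G at *
  generalize len a b = r at *
  generalize len c d = R at *
  generalize ang a b = α at *
  generalize ang c d = β at *
  have hk : (r * R) * sin (β - α) = 1 := by
    rw [sin_sub]; linarith
  have hk0 : 0 < r * R := by positivity
  have hs : 0 < sin (β - α) := by
    by_contra hneg
    push Not at hneg
    nlinarith
  have hD : 0 < β - α := by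
    by_contra hneg
    push Not at hneg
    have := sin_nonpos_of_nonpos_of_neg_pi_le hneg (by linarith [pi_pos])
    linarith
  have hb := angle_bound α β hD (by linarith)
  have hGE : G = (r * R) * (2 * (cos α * sin α) * (cos β * sin β)
      - cos (β - α) * ((cos α * sin α) ^ 2 + (cos β * sin β) ^ 2)
      + sin (β - α) * (Jf β - Jf α)) := by
    rw [hG, cos_sub]
    linear_combination (-(Jf β - Jf α)) * hk
  rw [hGE, abs_mul, abs_of_pos hk0]
  calc _ ≤ r * R * sin (β - α) ^ 4 * (r * R) ^ 3 := by gcongr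
    _ = (r * R * sin (β - α)) ^ 4 := by ring
    _ = 1 := by rw [hk, one_pow]

theorem len_ge (a b : ℕ) : ((a : ℝ) + b) ^ 2 ≤ 2 * len a b ^ 2 := by
  rw [len_sq]
  nlinarith [sq_nonneg ((a : ℝ) - b)]

theorem one_le_len (a b : ℕ) (hab : 0 < a + b) : 1 ≤ len a b := by
  have hl := len_pos a b hab
  have h1 := len_sq a b
  have h2 : 1 ≤ a ^ 2 + b ^ 2 := by
    by_contra hh
    have : a ^ 2 = 0 := by omega
    have : b ^ 2 = 0 := by omega
    simp_all
  have h3 : (1 : ℝ) ≤ (a : ℝ) ^ 2 + (b : ℝ) ^ 2 := by exact_mod_cast h2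
  nlinarith

/-- `Gf` on the index set. -/
noncomputable def Gx (x : Idx) : ℝ := Gf x.1.1 x.1.2.1 x.1.2.2.1 x.1.2.2.2

theorem Gx_bound (x : Idx) : |Gx x| ≤ 4 * tau x ^ 2 := by
  have p1 : 0 < x.1.1 + x.1.2.1 := by exact_mod_cast pos_fst x
  have p2 : 0 < x.1.2.2.1 + x.1.2.2.2 := by exact_mod_cast pos_snd x
  have q1 := pos_fst x
  have q2 := pos_snd x
  have hb := Gf_bound _ _ _ _ p1 p2 x.2.2
  have l1 := one_le_len _ _ p1
  have l2 := one_le_len _ _ p2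
  have g1 := len_ge x.1.1 x.1.2.1
  have g2 := len_ge x.1.2.2.1 x.1.2.2.2
  unfold Gx tau
  generalize Gf _ _ _ _ = G at *
  generalize len x.1.1 _ = r at *
  generalize len x.1.2.2.1 _ = R at *
  generalize (x.1.1 : ℝ) + x.1.2.1 = p at *
  generalize (x.1.2.2.1 : ℝ) + x.1.2.2.2 = q at *
  have hk1 : 1 ≤ r * R := by nlinarith
  have h1 : (p * q) ^ 2 ≤ 4 * (r * R) ^ 2 := by
    calc (p * q) ^ 2 = p ^ 2 * q ^ 2 := by ring
      _ ≤ (2 * r ^ 2) * (2 * R ^ 2) := by gcongr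
      _ = _ := by ring
  have h2 : (r * R) ^ 2 ≤ (r * R) ^ 3 := pow_le_pow_right₀ hk1 (by norm_num)
  have h3 : |G| * (p * q) ^ 2 ≤ 4 := by
    calc |G| * (p * q) ^ 2 ≤ |G| * (4 * (r * R) ^ 3) := by gcongr; linarith
      _ ≤ 4 := by linarith
  have hpq : 0 < (p * q) ^ 2 := by positivity
  rw [one_div, inv_pow, ← div_eq_mul_inv, le_div_iff₀ hpq]
  exact h3

/-- The summand. -/
noncomputable def tx (x : Idx) : ℝ := (h x.val.1 x.val.2.1 + h x.val.2.2.1 x.val.2.2.2 -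
        h (x.val.1 + x.val.2.2.1) (x.val.2.1 + x.val.2.2.2)) ^ 2

theorem tx_eq (x : Idx) : tx x = Gx x - Gx (lft x) - Gx (rgt x) := by
  have p1 : 0 < x.1.1 + x.1.2.1 := by exact_mod_cast pos_fst x
  have p2 : 0 < x.1.2.2.1 + x.1.2.2.2 := by exact_mod_cast pos_snd x
  obtain ⟨⟨a, b, c, d⟩, hx⟩ := x
  simp only at p1 p2
  have r1 := len_pos a b p1
  have r2 := len_pos c d p2
  have r3 := len_pos (a + c) (b + d) (by omega)
  have s1 := len_sq a b
  have s2 := len_sq c d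
  have s3 := len_sq (a + c) (b + d)
  simp only [tx, Gx, lft, rgt, Gf]
  push_cast at s3 ⊢
  generalize h a b = f1
  generalize h c d = f2
  generalize h (a + c) (b + d) = f3
  have e1 : f1 ^ 2 = (f1 / len a b) ^ 2 * ((a : ℝ) ^ 2 + (b : ℝ) ^ 2) := by
    rw [← s1]; field_simp
  have e2 : f2 ^ 2 = (f2 / len c d) ^ 2 * ((c : ℝ) ^ 2 + (d : ℝ) ^ 2) := by
    rw [← s2]; field_simp
  have e3 : f3 ^ 2 = (f3 / len (a + c) (b + d)) ^ 2 *
      (((a : ℝ) + c) ^ 2 + ((b : ℝ) + d) ^ 2) := by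
    rw [← s3]; field_simp
  linear_combination e1 + e2 + e3

theorem Gx_root : Gx root = 3 * π / 16 := by
  have e1 : ang 1 0 = 0 := by
    have : (⟨((1 : ℕ) : ℝ), ((0 : ℕ) : ℝ)⟩ : ℂ) = 1 := by
      apply Complex.ext <;> simp
    rw [ang, this, Complex.arg_one]
  have e2 : ang 0 1 = π / 2 := by
    have : (⟨((0 : ℕ) : ℝ), ((1 : ℕ) : ℝ)⟩ : ℂ) = Complex.I := by
      apply Complex.ext <;> simp
    rw [ang, this, Complex.arg_I]
  simp only [Gx, root, Gf, e1, e2, Jf]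
  rw [show 4 * (π / 2) = 2 * π by ring, sin_two_pi]
  simp [h]
  ring

theorem sum_G_le (n : ℕ) : |∑ x ∈ Lv n, Gx x| ≤ 4 * (1 / ((n : ℝ) + 1)) := by
  calc |∑ x ∈ Lv n, Gx x| ≤ ∑ x ∈ Lv n, |Gx x| := Finset.abs_sum_le_sum_abs _ _
    _ ≤ ∑ x ∈ Lv n, 4 * (1 / ((n : ℝ) + 1)) * tau x := by
        apply Finset.sum_le_sum
        intro x hx
        have h1 := Gx_bound x
        have h2 := tau_le n x hx
        have h3 : 0 ≤ tau x := by
          unfold tau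
          positivity
        nlinarith
    _ = 4 * (1 / ((n : ℝ) + 1)) := by rw [← Finset.mul_sum, sum_tau, mul_one]

theorem tendsto_sum_Tr :
    Filter.Tendsto (fun n => ∑ x ∈ Tr n, tx x) Filter.atTop (nhds (3 * π / 16)) := by
  have h0 : Filter.Tendsto (fun n => ∑ x ∈ Lv n, Gx x) Filter.atTop (nhds 0) := by
    apply squeeze_zero_norm (a := fun n : ℕ => 4 * (1 / ((n : ℝ) + 1)))
    · intro n
      exact sum_G_le n
    · simpa using (tendsto_one_div_add_atTop_nhds_zero_nat (𝕜 := ℝ)).const_mul 4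
  have h1 : (fun n => ∑ x ∈ Tr n, tx x) = fun n => 3 * π / 16 - ∑ x ∈ Lv n, Gx x := by
    funext n
    rw [sum_Tr n Gx tx tx_eq, Gx_root]
  rw [h1]
  simpa using h0.const_sub (3 * π / 16)

theorem hasSum_tx : HasSum tx (3 * π / 16) := by
  have hnn : ∀ x, 0 ≤ tx x := fun x => sq_nonneg _
  have hTr : Filter.Tendsto Tr Filter.atTop Filter.atTop :=
    Filter.tendsto_atTop_finset_of_monotone Tr_mono fun x => ⟨_, mem_Tr _ x le_rfl⟩
  have hmono : Monotone fun n => ∑ x ∈ Tr n, tx x := fun m n hmn =>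
    Finset.sum_le_sum_of_subset_of_nonneg (Tr_mono hmn) fun x _ _ => hnn x
  have hsum : Summable tx := by
    apply summable_of_sum_le (c := 3 * π / 16) hnn
    intro u
    obtain ⟨n, hn⟩ := (hTr.eventually (Filter.eventually_ge_atTop u)).exists
    calc ∑ x ∈ u, tx x ≤ ∑ x ∈ Tr n, tx x :=
          Finset.sum_le_sum_of_subset_of_nonneg hn fun x _ _ => hnn x
      _ ≤ 3 * π / 16 := hmono.ge_of_tendsto tendsto_sum_Tr n
  have h1 := hsum.hasSum.comp hTr
  have h2 := tendsto_nhds_unique h1 tendsto_sum_Tr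
  rw [← h2]
  exact hsum.hasSum

theorem sum_astroid_sq :
    HasSum (fun x : {x : ℕ × ℕ × ℕ × ℕ //
        1 ≤ x.1 ∧ x.1 * x.2.2.2 = x.2.1 * x.2.2.1 + 1} =>
      (h x.val.1 x.val.2.1 + h x.val.2.2.1 x.val.2.2.2 -
        h (x.val.1 + x.val.2.2.1) (x.val.2.1 + x.val.2.2.2)) ^ 2) (3 * π / 16) := by
  exact hasSum_tx
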